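/- arXiv:2507.14103 — 8 statements merged into one kernel-verified Lean document; each statement's English description precedes it below -/
import Mathlib

section
/- Let α: I → ℝ³ be a unit-speed spacelike pseudo-null curve. Then the translation surface X(s,t) = α(s) + α(t) obtained by summing α with itself satisfies the zero-mean-curvature equation: det(α'(s), α'(t), α''(s)) + det(α'(s), α'(t), α''(t)) = 0 for all s, t ∈ I. -/
open Real

noncomputable def lprod (u v : Fin 3 → ℝ) : ℝ :=
  u 0 * v 0 + u 1 * v 1 - u 2 * v 2

noncomputable def det3 (u v w : Fin 3 → ℝ) : ℝ :=
  u 0 * (v 1 * w 2 - v 2 * w 1) - u 1 * (v 0 * w 2 - v 2 * w 0) +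
    u 2 * (v 0 * w 1 - v 1 * w 0)

/-- A real function with zero derivative on an open convex set is constant there. -/
theorem eq_of_hasDerivAt_zero {I : Set ℝ} (hIo : IsOpen I) (hIc : Convex ℝ I) {f : ℝ → ℝ}
    (hf : ∀ s ∈ I, HasDerivAt f 0 s) {s t : ℝ} (hs : s ∈ I) (ht : t ∈ I) : f s = f t :=
  hIo.is_const_of_deriv_eq_zero hIc.isPreconnected
    (fun r hr => (hf r hr).differentiableAt.differentiableWithinAt)
    (fun r hr => (hf r hr).deriv) hs ht

/-- The third coordinate of a nonzero null vector does not vanish. -/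
theorem apply_two_ne_zero_of_lprod_self_eq_zero {v : Fin 3 → ℝ} (hv : v ≠ 0)
    (hnull : lprod v v = 0) : v 2 ≠ 0 := by
  intro h
  unfold lprod at hnull
  rw [h] at hnull
  have h0 : v 0 = 0 := by nlinarith [sq_nonneg (v 0), sq_nonneg (v 1)]
  have h1 : v 1 = 0 := by nlinarith [sq_nonneg (v 0), sq_nonneg (v 1)]
  apply hv
  ext i
  fin_cases i <;> simpa

/-- The Leibniz rule for the Lorentzian product. -/
theorem hasDerivAt_lprod {f g : ℝ → Fin 3 → ℝ} {f' g' : Fin 3 → ℝ} {s : ℝ}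
    (hf : HasDerivAt f f' s) (hg : HasDerivAt g g' s) :
    HasDerivAt (fun r => lprod (f r) (g r)) (lprod f' (g s) + lprod (f s) g') s := by
  have h := hasDerivAt_pi.1 hf
  have k := hasDerivAt_pi.1 hg
  unfold lprod
  refine (((h 0).mul (k 0)).add ((h 1).mul (k 1)) |>.sub ((h 2).mul (k 2))).congr_deriv ?_
  ring

/-- If the Lorentzian square of `f` is constant on an open set, `f` is orthogonal to its
derivative there. -/
theorem lprod_deriv_eq_zero {I : Set ℝ} (hIo : IsOpen I) {f : ℝ → Fin 3 → ℝ} {f' : Fin 3 → ℝ}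
    {k s : ℝ} (hs : s ∈ I) (hk : ∀ r ∈ I, lprod (f r) (f r) = k) (hf : HasDerivAt f f' s) :
    lprod (f s) f' = 0 := by
  have h : HasDerivAt (fun r => lprod (f r) (f r)) 0 s :=
    (hasDerivAt_const s k).congr_of_eventuallyEq
      (Filter.eventually_of_mem (hIo.mem_nhds hs) hk)
  have h2 := (hasDerivAt_lprod hf hf).unique h
  unfold lprod at *
  linarith

/-- The orthogonal complement of the span of a unit spacelike vector `T` and an orthogonal
null vector `N` is the line through `N`. -/
theorem mul_eq_mul_of_lprod_eq_zero {T N M : Fin 3 → ℝ} (hT : lprod T T = 1)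
    (hN2 : N 2 ≠ 0) (hN : lprod N N = 0) (hTN : lprod T N = 0) (hTM : lprod T M = 0)
    (hNM : lprod N M = 0) : M 0 * N 2 = N 0 * M 2 ∧ M 1 * N 2 = N 1 * M 2 := by
  unfold lprod at *
  set D := T 0 * N 1 - T 1 * N 0 with hD
  have hD2 : D ^ 2 = N 2 ^ 2 := by
    rw [hD]
    linear_combination (N 2 ^ 2) * hT + (T 0 ^ 2 + T 1 ^ 2) * hN
      - (T 0 * N 0 + T 1 * N 1 + T 2 * N 2) * hTN
  have hD0 : D ≠ 0 := fun h => hN2 (by simpa [h] using hD2.symm)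
  constructor <;> apply mul_left_cancel₀ hD0 <;> rw [hD]
  · linear_combination N 1 * N 2 * hTM - T 1 * N 2 * hNM - N 1 * M 2 * hTN + T 1 * M 2 * hN
  · linear_combination -N 0 * N 2 * hTM + T 0 * N 2 * hNM + N 0 * M 2 * hTN - T 0 * M 2 * hN

/-- the translation surface `X(s,t) = α(s) + α(t)` generated by a
unit-speed spacelike pseudo-null curve and itself satisfies the
zero-mean-curvature equation. -/
theorem stmt_5 (I : Set ℝ) (hIo : IsOpen I) (hIc : Convex ℝ I)
    (α : ℝ → Fin 3 → ℝ)
    (hαsm : ContDiffOn ℝ (⊤ : ℕ∞) α I)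
    (hαu : ∀ s ∈ I, lprod (deriv α s) (deriv α s) = 1)
    (hα2 : ∀ s ∈ I, deriv (deriv α) s ≠ 0)
    (hαnull : ∀ s ∈ I, lprod (deriv (deriv α) s) (deriv (deriv α) s) = 0) :
    ∀ s ∈ I, ∀ t ∈ I,
      det3 (deriv α s) (deriv α t) (deriv (deriv α) s) +
        det3 (deriv α s) (deriv α t) (deriv (deriv α) t) = 0 := by
  have hT : ∀ s ∈ I, HasDerivAt (deriv α) (deriv (deriv α) s) s := fun s hs =>
    (((hαsm.deriv_of_isOpen (m := 2) hIo (WithTop.coe_le_coe.2 le_top)).differentiableOn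
      (by norm_num)).differentiableAt (hIo.mem_nhds hs)).hasDerivAt
  have hN : ∀ s ∈ I, HasDerivAt (deriv (deriv α)) (deriv (deriv (deriv α)) s) s := fun s hs =>
    ((((hαsm.deriv_of_isOpen (m := 2) hIo (WithTop.coe_le_coe.2 le_top)).deriv_of_isOpen
      (m := 1) hIo (by norm_num)).differentiableOn
      (by norm_num)).differentiableAt (hIo.mem_nhds hs)).hasDerivAt
  generalize deriv (deriv (deriv α)) = M at *
  generalize deriv (deriv α) = N at *
  generalize deriv α = T at *
  have hN2 : ∀ s ∈ I, N s 2 ≠ 0 := fun s hs =>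
    apply_two_ne_zero_of_lprod_self_eq_zero (hα2 s hs) (hαnull s hs)
  have hTN : ∀ s ∈ I, lprod (T s) (N s) = 0 := fun s hs =>
    lprod_deriv_eq_zero hIo hs hαu (hT s hs)
  have hTM : ∀ s ∈ I, lprod (T s) (M s) = 0 := fun s hs => by
    have h : HasDerivAt (fun r => lprod (T r) (N r)) 0 s :=
      (hasDerivAt_const s 0).congr_of_eventuallyEq
        (Filter.eventually_of_mem (hIo.mem_nhds hs) hTN)
    linarith [(hasDerivAt_lprod (hT s hs) (hN s hs)).unique h, hαnull s hs]
  have hMN : ∀ s ∈ I, M s 0 * N s 2 = N s 0 * M s 2 ∧ M s 1 * N s 2 = N s 1 * M s 2 :=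
    fun s hs => mul_eq_mul_of_lprod_eq_zero (hαu s hs) (hN2 s hs) (hαnull s hs) (hTN s hs)
      (hTM s hs) (lprod_deriv_eq_zero hIo hs hαnull (hN s hs))
  have hcoord : ∀ i : Fin 3, (∀ s ∈ I, M s i * N s 2 = N s i * M s 2) →
      ∀ s ∈ I, ∀ t ∈ I, ∃ u : ℝ, N s i = u * N s 2 ∧ N t i = u * N t 2 ∧
        T s i - u * T s 2 = T t i - u * T t 2 := by
    intro i hi s hs t ht
    have hratio : ∀ r ∈ I, N r i = N s i / N s 2 * N r 2 := by
      intro r hr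
      have h : N s i / N s 2 = N r i / N r 2 := by
        refine eq_of_hasDerivAt_zero hIo hIc (f := fun r => N r i / N r 2) ?_ hs hr
        intro q hq
        have h := hasDerivAt_pi.1 (hN q hq)
        refine ((h i).div (h 2) (hN2 q hq)).congr_deriv ?_
        rw [hi q hq, sub_self, zero_div]
      rw [h, div_mul_cancel₀ _ (hN2 r hr)]
    refine ⟨N s i / N s 2, hratio s hs, hratio t ht, ?_⟩
    refine eq_of_hasDerivAt_zero hIo hIc
      (f := fun r => T r i - N s i / N s 2 * T r 2) ?_ hs ht
    intro q hq
    have h := hasDerivAt_pi.1 (hT q hq)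
    refine ((h i).sub ((h 2).const_mul (N s i / N s 2))).congr_deriv ?_
    rw [← hratio q hq, sub_self]
  intro s hs t ht
  obtain ⟨u, hu₁, hu₂, hu₃⟩ := hcoord 0 (fun s hs => (hMN s hs).1) s hs t ht
  obtain ⟨v, hv₁, hv₂, hv₃⟩ := hcoord 1 (fun s hs => (hMN s hs).2) s hs t ht
  unfold det3
  rw [hu₁, hu₂, hv₁, hv₂, eq_add_of_sub_eq hu₃, eq_add_of_sub_eq hv₃]
  ring
end

section
/- Let α: I → ℝ³ be a unit-speed spacelike pseudo-null curve and let k ≠ 0 be a real number such that α'''(s) = k α''(s) for all s ∈ I. Then there exist a lightlike vector v ∈ ℝ³, a vector b ∈ ℝ³ with ⟨b,b⟩_L = k² and ⟨v,b⟩_L = 0, and a vector w ∈ ℝ³, such that α(s) = e^{k s} v − (s/k) b + w for all s ∈ I. -/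
open Real

theorem exists_forall_eq_of_hasDerivAt_zero {E : Type*} [NormedAddCommGroup E] [NormedSpace ℝ E]
    {I : Set ℝ} (hIo : IsOpen I) (hIc : Convex ℝ I) {f : ℝ → E}
    (hf : ∀ s ∈ I, HasDerivAt f 0 s) : ∃ c, ∀ s ∈ I, f s = c :=
  hIo.exists_is_const_of_deriv_eq_zero hIc.isPreconnected
    (fun s hs => (hf s hs).differentiableAt.differentiableWithinAt) fun s hs => (hf s hs).deriv

/-- On an open interval, a function whose third derivative is `k ≠ 0` times its second derivative
is a combination of `exp (k * s)`, `s` and a constant. -/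
theorem exists_eq_exp_of_deriv_three_eq_smul {E : Type*} [NormedAddCommGroup E] [NormedSpace ℝ E]
    {I : Set ℝ} (hIo : IsOpen I) (hIc : Convex ℝ I) {f : ℝ → E}
    (hf : ContDiffOn ℝ (⊤ : ℕ∞) f I) {k : ℝ} (hk : k ≠ 0)
    (hf3 : ∀ s ∈ I, deriv (deriv (deriv f)) s = k • deriv (deriv f) s) :
    ∃ v d w : E, ∀ s ∈ I, deriv (deriv f) s = (k ^ 2 * exp (k * s)) • v ∧
      deriv f s = (k * exp (k * s)) • v + d ∧ f s = exp (k * s) • v + s • d + w := by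
  have hf1 : ContDiffOn ℝ (⊤ : ℕ∞) (deriv f) I := hf.deriv_of_isOpen hIo (by simp)
  have hf2 : ContDiffOn ℝ (⊤ : ℕ∞) (deriv (deriv f)) I := hf1.deriv_of_isOpen hIo (by simp)
  have hasDeriv {g : ℝ → E} (hg : ContDiffOn ℝ (⊤ : ℕ∞) g I) (s : ℝ) (hs : s ∈ I) :
      HasDerivAt g (deriv g s) s :=
    ((hg.differentiableOn (by simp)).differentiableAt (hIo.mem_nhds hs)).hasDerivAt
  have hexp (a s : ℝ) : HasDerivAt (fun t => exp (a * t)) (a * exp (a * s)) s := by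
    simpa [mul_comm] using ((hasDerivAt_id s).const_mul a).exp
  obtain ⟨c, hc⟩ : ∃ c, ∀ s ∈ I, exp (-k * s) • deriv (deriv f) s = c := by
    refine exists_forall_eq_of_hasDerivAt_zero hIo hIc fun s hs => ?_
    refine ((hexp (-k) s).smul (hasDeriv hf2 s hs)).congr_deriv ?_
    rw [hf3 s hs]
    module
  have h2 (s : ℝ) (hs : s ∈ I) : deriv (deriv f) s = (k ^ 2 * exp (k * s)) • (k ^ 2)⁻¹ • c := by
    have h : k ^ 2 * exp (k * s) * ((k ^ 2)⁻¹ * exp (-k * s)) = 1 := by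
      rw [neg_mul, exp_neg]
      field_simp
    rw [← hc s hs, smul_smul, smul_smul, mul_assoc _ (k ^ 2)⁻¹, h, one_smul]
  set v := (k ^ 2)⁻¹ • c
  obtain ⟨d, hd⟩ : ∃ d, ∀ s ∈ I, deriv f s - (k * exp (k * s)) • v = d := by
    refine exists_forall_eq_of_hasDerivAt_zero hIo hIc fun s hs => ?_
    refine ((hasDeriv hf1 s hs).sub (((hexp k s).const_mul k).smul_const v)).congr_deriv ?_
    rw [h2 s hs]
    module
  have h1 (s : ℝ) (hs : s ∈ I) : deriv f s = (k * exp (k * s)) • v + d := by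
    rw [← hd s hs]
    abel
  obtain ⟨w, hw⟩ : ∃ w, ∀ s ∈ I, f s - (exp (k * s) • v + s • d) = w := by
    refine exists_forall_eq_of_hasDerivAt_zero hIo hIc fun s hs => ?_
    refine ((hasDeriv hf s hs).sub
      (((hexp k s).smul_const v).add ((hasDerivAt_id s).smul_const d))).congr_deriv ?_
    rw [h1 s hs]
    module
  refine ⟨v, d, w, fun s hs => ⟨h2 s hs, h1 s hs, ?_⟩⟩
  rw [← hw s hs]
  abel

/-- a unit-speed spacelike pseudo-null curve with constant nonzero
pseudo-torsion `k` (i.e. `α''' = k α''`) is `α(s) = e^{ks}·v − (s/k)·b + w` with `v`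
lightlike and `b` spacelike of norm `k²`, orthogonal to `v`. -/
theorem stmt_7 (I : Set ℝ) (hIo : IsOpen I) (hIc : Convex ℝ I)
    (α : ℝ → Fin 3 → ℝ)
    (hαsm : ContDiffOn ℝ (⊤ : ℕ∞) α I)
    (hαu : ∀ s ∈ I, lprod (deriv α s) (deriv α s) = 1)
    (hα2 : ∀ s ∈ I, deriv (deriv α) s ≠ 0)
    (hαnull : ∀ s ∈ I, lprod (deriv (deriv α) s) (deriv (deriv α) s) = 0)
    (k : ℝ) (hk : k ≠ 0)
    (hα3 : ∀ s ∈ I, deriv (deriv (deriv α)) s = k • deriv (deriv α) s) :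
    ∃ (v b w : Fin 3 → ℝ), lprod v v = 0 ∧ v ≠ 0 ∧ lprod b b = k ^ 2 ∧
      lprod v b = 0 ∧
      ∀ s ∈ I, α s = Real.exp (k * s) • v - (s / k) • b + w := by
  rcases I.eq_empty_or_nonempty with rfl | ⟨s, hs⟩
  · refine ⟨![1, 0, 1], ![0, k, 0], 0, ?_, fun h => ?_, ?_, ?_, by simp⟩
    · simp [lprod]
    · simpa using congrFun h 0
    · simp [lprod, sq]
    · simp [lprod]
  obtain ⟨v, d, w, h⟩ := exists_eq_exp_of_deriv_three_eq_smul hIo hIc hαsm hk hα3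
  have hvv : lprod v v = 0 := by
    have h0 := hαnull s hs
    rw [(h s hs).1] at h0
    have h1 : (k ^ 2 * exp (k * s)) ^ 2 * lprod v v = 0 := by
      rw [← h0]
      simp only [lprod, Pi.smul_apply, smul_eq_mul]
      ring
    exact (mul_eq_zero.mp h1).resolve_left (by positivity)
  have hunit (t : ℝ) (ht : t ∈ I) : 2 * k * exp (k * t) * lprod v d + lprod d d = 1 := by
    have h0 := hαu t ht
    rw [(h t ht).2.1] at h0
    simp only [lprod, Pi.add_apply, Pi.smul_apply, smul_eq_mul] at h0 hvv ⊢
    linear_combination h0 - (k * exp (k * t)) ^ 2 * hvv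
  obtain ⟨t, hst, ht⟩ : ∃ t, s ≠ t ∧ t ∈ I := by
    obtain ⟨ε, hε, hball⟩ := Metric.isOpen_iff.mp hIo s hs
    refine ⟨s + ε / 2, by linarith, hball ?_⟩
    rw [Metric.mem_ball, Real.dist_eq, add_sub_cancel_left, abs_of_pos] <;> linarith
  have hvd : lprod v d = 0 := by
    have h0 : (2 * k * (exp (k * s) - exp (k * t))) * lprod v d = 0 := by
      linear_combination hunit s hs - hunit t ht
    refine (mul_eq_zero.mp h0).resolve_left (mul_ne_zero (by positivity) ?_)
    rw [sub_ne_zero, Ne, exp_eq_exp]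
    exact fun h => hst (mul_left_cancel₀ hk h)
  have hdd : lprod d d = 1 := by simpa [hvd] using hunit s hs
  refine ⟨v, -k • d, w, hvv, ?_, ?_, ?_, fun u hu => ?_⟩
  · rintro rfl
    exact hα2 s hs (by simp [(h s hs).1])
  · simp only [lprod, Pi.smul_apply, smul_eq_mul] at hdd ⊢
    linear_combination k ^ 2 * hdd
  · simp only [lprod, Pi.smul_apply, smul_eq_mul] at hvd ⊢
    linear_combination -k * hvd
  · rw [(h u hu).2.2, smul_smul, mul_neg, div_mul_cancel₀ _ hk]
    module
end

section
/- Let r, h ∈ ℝ with r² > h² > 0 and let α: ℝ → ℝ³ be the circular helix of type I, α(s) = (r cos φ(s), r sin φ(s), h φ(s)) with φ(s) = s/√(r² − h²) (a unit-speed spacelike curve). Then the translation surface Ψ(s,t) = α(s) + α(t) satisfies the zero-mean-curvature equation: det(α'(s), α'(t), α''(s)) + det(α'(s), α'(t), α''(t)) = 0 for all s, t ∈ ℝ. -/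
open Real

theorem hasDerivAt_helix {φ : ℝ → ℝ} {k : ℝ} (hφ : ∀ s, HasDerivAt φ k s) (r h s : ℝ) :
    HasDerivAt (fun s => ![r * Real.cos (φ s), r * Real.sin (φ s), h * φ s])
      ![r * (-Real.sin (φ s) * k), r * (Real.cos (φ s) * k), h * k] s := by
  rw [hasDerivAt_pi]
  intro i
  fin_cases i
  · exact (hφ s).cos.const_mul r
  · exact (hφ s).sin.const_mul r
  · exact (hφ s).const_mul h

theorem hasDerivAt_helix_velocity {φ : ℝ → ℝ} {k : ℝ} (hφ : ∀ s, HasDerivAt φ k s)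
    (r h s : ℝ) :
    HasDerivAt (fun s => ![r * (-Real.sin (φ s) * k), r * (Real.cos (φ s) * k), h * k])
      ![r * (-(Real.cos (φ s) * k) * k), r * (-Real.sin (φ s) * k * k), 0] s := by
  rw [hasDerivAt_pi]
  intro i
  fin_cases i
  · exact ((hφ s).sin.neg.mul_const k).const_mul r
  · exact ((hφ s).cos.mul_const k).const_mul r
  · exact hasDerivAt_const s (h * k)

/-- the translation surface `Ψ(s,t) = α(s) + α(t)` generated by a
circular helix of type I satisfies the zero-mean-curvature equation. -/
theorem stmt_10 (r h : ℝ) (h1 : h ^ 2 < r ^ 2) (h2 : 0 < h ^ 2)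
    (φ : ℝ → ℝ) (hφ : ∀ s, φ s = s / Real.sqrt (r ^ 2 - h ^ 2))
    (α : ℝ → Fin 3 → ℝ)
    (hα : ∀ s, α s = ![r * Real.cos (φ s), r * Real.sin (φ s), h * φ s]) :
    ∀ s t : ℝ,
      det3 (deriv α s) (deriv α t) (deriv (deriv α) s) +
        det3 (deriv α s) (deriv α t) (deriv (deriv α) t) = 0 := by
  intro s t
  have hφ' : ∀ s, HasDerivAt φ (1 / Real.sqrt (r ^ 2 - h ^ 2)) s := fun s => by
    rw [funext hφ]
    exact (hasDerivAt_id s).div_const _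
  generalize 1 / Real.sqrt (r ^ 2 - h ^ 2) = k at hφ'
  have hα' : deriv α =
      fun s => ![r * (-Real.sin (φ s) * k), r * (Real.cos (φ s) * k), h * k] := by
    rw [funext hα]
    exact funext fun s => (hasDerivAt_helix hφ' r h s).deriv
  rw [hα', (hasDerivAt_helix_velocity hφ' r h s).deriv,
    (hasDerivAt_helix_velocity hφ' r h t).deriv]
  simp only [det3, Matrix.cons_val]
  linear_combination (r ^ 2 * h * k ^ 4) *
    (Real.sin_sq_add_cos_sq (φ t) - Real.sin_sq_add_cos_sq (φ s))
end

section
/- Let r, h ∈ ℝ with r ≠ 0 and h ≠ 0, and let α: ℝ → ℝ³ be the circular helix of type II, α(s) = (h φ(s), r sinh φ(s), r cosh φ(s)) with φ(s) = s/√(h² + r²) (a unit-speed spacelike curve). Then the translation surface Ψ(s,t) = α(s) + α(t) satisfies the zero-mean-curvature equation: det(α'(s), α'(t), α''(s)) + det(α'(s), α'(t), α''(t)) = 0 for all s, t ∈ ℝ. -/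
open Real

theorem hasDerivAt_helix_s11 (a b k s : ℝ) :
    HasDerivAt (fun x : ℝ => (![a * (k * x), b * sinh (k * x), b * cosh (k * x)] : Fin 3 → ℝ))
      ![a * k, b * k * cosh (k * s), b * k * sinh (k * s)] s := by
  have hk : HasDerivAt (fun x : ℝ => k * x) k s := by
    simpa using (hasDerivAt_id s).const_mul k
  rw [hasDerivAt_pi]
  intro i
  fin_cases i
  · exact hk.const_mul a
  · exact (hk.sinh.const_mul b).congr_deriv (by simp; ring)
  · exact (hk.cosh.const_mul b).congr_deriv (by simp; ring)

theorem hasDerivAt_helix_velocity_s11 (a b k s : ℝ) :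
    HasDerivAt (fun x : ℝ => (![a, b * cosh (k * x), b * sinh (k * x)] : Fin 3 → ℝ))
      ![0, b * k * sinh (k * s), b * k * cosh (k * s)] s := by
  have hk : HasDerivAt (fun x : ℝ => k * x) k s := by
    simpa using (hasDerivAt_id s).const_mul k
  rw [hasDerivAt_pi]
  intro i
  fin_cases i
  · exact hasDerivAt_const s a
  · exact (hk.cosh.const_mul b).congr_deriv (by simp; ring)
  · exact (hk.sinh.const_mul b).congr_deriv (by simp; ring)

/-- the translation surface `Ψ(s,t) = α(s) + α(t)` generated by a
circular helix of type II satisfies the zero-mean-curvature equation. -/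
theorem stmt_11 (r h : ℝ) (hr : r ≠ 0) (hh : h ≠ 0)
    (φ : ℝ → ℝ) (hφ : ∀ s, φ s = s / Real.sqrt (h ^ 2 + r ^ 2))
    (α : ℝ → Fin 3 → ℝ)
    (hα : ∀ s, α s = ![h * φ s, r * Real.sinh (φ s), r * Real.cosh (φ s)]) :
    ∀ s t : ℝ,
      det3 (deriv α s) (deriv α t) (deriv (deriv α) s) +
        det3 (deriv α s) (deriv α t) (deriv (deriv α) t) = 0 := by
  intro s t
  set k : ℝ := (√(h ^ 2 + r ^ 2))⁻¹
  have hα' : α = fun x => ![h * (k * x), r * sinh (k * x), r * cosh (k * x)] := by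
    funext x
    have hφx : φ x = k * x := by rw [hφ, div_eq_inv_mul]
    rw [hα, hφx]
  have hd : deriv α = fun x => ![h * k, r * k * cosh (k * x), r * k * sinh (k * x)] := by
    funext x
    rw [hα']
    exact (hasDerivAt_helix_s11 h r k x).deriv
  have hdd (x : ℝ) : deriv (deriv α) x =
      ![0, r * k * k * sinh (k * x), r * k * k * cosh (k * x)] := by
    rw [hd]
    exact (hasDerivAt_helix_velocity_s11 (h * k) (r * k) k x).deriv
  rw [hdd, hdd, hd]
  simp only [det3, Matrix.cons_val]
  linear_combination (h * k * (r * k) * (r * k * k)) *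
    (cosh_sq_sub_sinh_sq (k * t) - cosh_sq_sub_sinh_sq (k * s))
end

section
/- Let α: I → ℝ³ and β: J → ℝ³ be unit-speed spacelike curves of Frenet type, with α planar, and assume the translation surface X(s,t) = α(s) + β(t) is maximal. Assume moreover that for every s ∈ I there exists t ∈ J with det(α'(s), α''(s), β'(t)) ≠ 0. Let ε ∈ {−1,1} be such that ε⟨α''(s),α''(s)⟩_L > 0 for all s ∈ I and set κ(s) = √(ε⟨α''(s),α''(s)⟩_L). Then the curvature κ of α satisfies (κ'/κ)'(s) + ε κ(s)² = 0 for all s ∈ I. -/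
open Real

theorem HasDerivAt.lprod {f g : ℝ → Fin 3 → ℝ} {f' g' : Fin 3 → ℝ} {s : ℝ}
    (hf : HasDerivAt f f' s) (hg : HasDerivAt g g' s) :
    HasDerivAt (fun u => _root_.lprod (f u) (g u))
      (_root_.lprod f' (g s) + _root_.lprod (f s) g') s := by
  rw [hasDerivAt_pi] at hf hg
  have h := (((hf 0).mul (hg 0)).add ((hf 1).mul (hg 1))).sub ((hf 2).mul (hg 2))
  refine h.congr_deriv ?_
  simp only [_root_.lprod]
  ring

theorem HasDerivAt.det3_const_right {f g : ℝ → Fin 3 → ℝ} {f' g' : Fin 3 → ℝ} {s : ℝ}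
    (hf : HasDerivAt f f' s) (hg : HasDerivAt g g' s) (w : Fin 3 → ℝ) :
    HasDerivAt (fun u => det3 (f u) (g u) w) (det3 f' (g s) w + det3 (f s) g' w) s := by
  rw [hasDerivAt_pi] at hf hg
  have h := (((hf 0).mul (((hg 1).mul_const (w 2)).sub ((hg 2).mul_const (w 1)))).sub
    ((hf 1).mul (((hg 0).mul_const (w 2)).sub ((hg 2).mul_const (w 0))))).add
    ((hf 2).mul (((hg 0).mul_const (w 1)).sub ((hg 1).mul_const (w 0))))
  refine h.congr_deriv ?_
  simp only [det3, Pi.sub_apply]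
  ring

/-- A function that is constant on an open set has zero derivative there. -/
theorem HasDerivAt.eq_zero_of_eqOn_const {I : Set ℝ} (hI : IsOpen I) {f : ℝ → ℝ} {f' c s : ℝ}
    (hs : s ∈ I) (hc : ∀ u ∈ I, f u = c) (hf : HasDerivAt f f' s) : f' = 0 := by
  refine hf.unique ((hasDerivAt_const s c).congr_of_eventuallyEq ?_)
  filter_upwards [hI.mem_nhds hs] with u hu using hc u hu

/-- The Lorentzian cross product. -/
def lcross (u v : Fin 3 → ℝ) : Fin 3 → ℝ :=
  ![u 1 * v 2 - u 2 * v 1, u 2 * v 0 - u 0 * v 2, -(u 0 * v 1 - u 1 * v 0)]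

theorem lprod_lcross_expansion (u v x : Fin 3 → ℝ) :
    (lprod u u * lprod v v - lprod u v ^ 2) • x =
      (lprod x u * lprod v v - lprod x v * lprod u v) • u +
        (lprod x v * lprod u u - lprod x u * lprod u v) • v -
          lprod x (lcross u v) • lcross u v := by
  ext i
  fin_cases i <;> simp [lprod, lcross] <;> ring

/-- Two vectors orthogonal to a nondegenerate pair `u, v` and to each other cannot both be
nonzero. -/
theorem eq_zero_of_lprod_eq_zero {u v w r : Fin 3 → ℝ}
    (hG : lprod u u * lprod v v - lprod u v ^ 2 ≠ 0) (hw : w ≠ 0)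
    (hwu : lprod w u = 0) (hwv : lprod w v = 0)
    (hru : lprod r u = 0) (hrv : lprod r v = 0) (hrw : lprod r w = 0) : r = 0 := by
  have ew := lprod_lcross_expansion u v w
  have er := lprod_lcross_expansion u v r
  simp only [hwu, hwv, hru, hrv, zero_mul, sub_zero, zero_smul, zero_add, zero_sub] at ew er
  have hwn : lprod w (lcross u v) ≠ 0 := by
    intro h
    rw [h, zero_smul, neg_zero] at ew
    exact (smul_ne_zero hG hw) ew
  have hrn : lprod r (lcross u v) = 0 := by
    have h : lprod r ((lprod u u * lprod v v - lprod u v ^ 2) • w) =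
        (lprod u u * lprod v v - lprod u v ^ 2) * lprod r w := by
      simp only [lprod, Pi.smul_apply, smul_eq_mul]
      ring
    have h' : lprod r (-(lprod w (lcross u v) • lcross u v)) =
        -(lprod w (lcross u v) * lprod r (lcross u v)) := by
      simp only [lprod, Pi.neg_apply, Pi.smul_apply, smul_eq_mul]
      ring
    rw [ew, h', hrw, mul_zero, neg_eq_zero] at h
    exact (mul_eq_zero.1 h).resolve_left hwn
  rw [hrn, zero_smul, neg_zero] at er
  exact (smul_eq_zero.1 er).resolve_left hG

/-- The Frenet equation of a planar unit-speed curve, written without normalising the normal. -/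
theorem planar_frenet_equation {u v a w : Fin 3 → ℝ} (hw : w ≠ 0)
    (huu : lprod u u = 1) (hvu : lprod v u = 0) (hvv : lprod v v ≠ 0)
    (hau : lprod a u = -lprod v v)
    (huw : lprod u w = 0) (hvw : lprod v w = 0) (haw : lprod a w = 0) :
    a = -lprod v v • u + (lprod a v / lprod v v) • v := by
  have comm : ∀ x y, lprod x y = lprod y x := fun x y => by simp only [lprod]; ring
  have lin : ∀ (b c : ℝ) (y : Fin 3 → ℝ),
      lprod (a - (b • u + c • v)) y = lprod a y - (b * lprod u y + c * lprod v y) := by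
    intro b c y
    simp only [lprod, Pi.sub_apply, Pi.add_apply, Pi.smul_apply, smul_eq_mul]
    ring
  have huv : lprod u v = 0 := by rw [comm, hvu]
  refine sub_eq_zero.1 (eq_zero_of_lprod_eq_zero (u := u) (v := v) ?_ hw ?_ ?_ ?_ ?_ ?_)
  · simpa [huu, huv] using hvv
  · rw [comm, huw]
  · rw [comm, hvw]
  · rw [lin, hau, huu, hvu]
    ring
  · rw [lin, huv]
    field_simp
    ring
  · rw [lin, huw, hvw, haw]
    ring

/-- for a maximal translation surface generated by Frenet-type curves
with `α` planar and the nondegeneracy condition `∀ s ∃ t, det(α',α'',β') ≠ 0`, the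
curvature of `α` satisfies `(κ'/κ)' + ε κ² = 0`. -/
theorem stmt_16 (I J : Set ℝ) (hIo : IsOpen I) (hIc : Convex ℝ I)
    (hJo : IsOpen J) (hJc : Convex ℝ J)
    (α β : ℝ → Fin 3 → ℝ)
    (hαsm : ContDiffOn ℝ (⊤ : ℕ∞) α I) (hβsm : ContDiffOn ℝ (⊤ : ℕ∞) β J)
    (hαu : ∀ s ∈ I, lprod (deriv α s) (deriv α s) = 1)
    (hβu : ∀ t ∈ J, lprod (deriv β t) (deriv β t) = 1)
    (hαF : ∀ s ∈ I, lprod (deriv (deriv α) s) (deriv (deriv α) s) ≠ 0)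
    (hβF : ∀ t ∈ J, lprod (deriv (deriv β) t) (deriv (deriv β) t) ≠ 0)
    (hαplanar : ∃ (w : Fin 3 → ℝ) (d : ℝ), w ≠ 0 ∧ ∀ s ∈ I, lprod (α s) w = d)
    (hmax : ∀ s ∈ I, ∀ t ∈ J,
      det3 (deriv α s) (deriv β t) (deriv (deriv α) s) +
        det3 (deriv α s) (deriv β t) (deriv (deriv β) t) = 0)
    (hnondeg : ∀ s ∈ I, ∃ t ∈ J,
      det3 (deriv α s) (deriv (deriv α) s) (deriv β t) ≠ 0)
    (ε : ℝ) (hε : ε = 1 ∨ ε = -1)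
    (hεsign : ∀ s ∈ I, 0 < ε * lprod (deriv (deriv α) s) (deriv (deriv α) s))
    (κ : ℝ → ℝ)
    (hκ : ∀ s ∈ I,
      κ s = Real.sqrt (ε * lprod (deriv (deriv α) s) (deriv (deriv α) s))) :
    ∀ s ∈ I, deriv (fun u => deriv κ u / κ u) s + ε * κ s ^ 2 = 0 := by
  obtain ⟨w, d, hw, hplane⟩ := hαplanar
  have smooth₁ : ContDiffOn ℝ (⊤ : ℕ∞) (deriv α) I := hαsm.deriv_of_isOpen hIo (by simp)
  have smooth₂ : ContDiffOn ℝ (⊤ : ℕ∞) (deriv (deriv α)) I :=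
    smooth₁.deriv_of_isOpen hIo (by simp)
  have hasDeriv : ∀ f : ℝ → Fin 3 → ℝ, ContDiffOn ℝ (⊤ : ℕ∞) f I →
      ∀ s ∈ I, HasDerivAt f (deriv f s) s := fun f hf s hs =>
    ((hf.differentiableOn (by simp)).differentiableAt (hIo.mem_nhds hs)).hasDerivAt
  have d₀ := hasDeriv _ hαsm
  have d₁ := hasDeriv _ smooth₁
  have d₂ := hasDeriv _ smooth₂
  set T := deriv α with hT
  set A := deriv T with hA
  have comm : ∀ x y, lprod x y = lprod y x := fun x y => by simp only [lprod]; ring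
  have lprod_zero : ∀ x, lprod x 0 = 0 := fun x => by simp [lprod]
  have hTw : ∀ s ∈ I, lprod (T s) w = 0 := fun s hs => by
    have h := ((d₀ s hs).lprod (hasDerivAt_const s w)).eq_zero_of_eqOn_const hIo hs hplane
    rwa [lprod_zero, add_zero] at h
  have hAw : ∀ s ∈ I, lprod (A s) w = 0 := fun s hs => by
    have h := ((d₁ s hs).lprod (hasDerivAt_const s w)).eq_zero_of_eqOn_const hIo hs hTw
    rwa [lprod_zero, add_zero] at h
  have hBw : ∀ s ∈ I, lprod (deriv A s) w = 0 := fun s hs => by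
    have h := ((d₂ s hs).lprod (hasDerivAt_const s w)).eq_zero_of_eqOn_const hIo hs hAw
    rwa [lprod_zero, add_zero] at h
  have hAT : ∀ s ∈ I, lprod (A s) (T s) = 0 := fun s hs => by
    have h := ((d₁ s hs).lprod (d₁ s hs)).eq_zero_of_eqOn_const hIo hs hαu
    linarith [comm (A s) (T s)]
  have hBT : ∀ s ∈ I, lprod (deriv A s) (T s) = -lprod (A s) (A s) := fun s hs => by
    have h := ((d₂ s hs).lprod (d₁ s hs)).eq_zero_of_eqOn_const hIo hs hAT
    linarith
  have frenet : ∀ s ∈ I, deriv A s = -lprod (A s) (A s) • T s +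
      (lprod (deriv A s) (A s) / lprod (A s) (A s)) • A s := fun s hs =>
    planar_frenet_equation hw (hαu s hs) (hAT s hs) (hαF s hs) (hBT s hs)
      (hTw s hs) (hAw s hs) (hBw s hs)
  have hlog : ∀ s ∈ I,
      deriv κ s / κ s = lprod (deriv A s) (A s) / lprod (A s) (A s) := by
    intro s hs
    have hpos := hεsign s hs
    have hd := (((d₂ s hs).lprod (d₂ s hs)).const_mul ε).sqrt hpos.ne'
    have hd' := hd.congr_of_eventuallyEq (f₁ := κ) (by
      filter_upwards [hIo.mem_nhds hs] with u hu using hκ u hu)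
    rw [hd'.deriv, hκ s hs, div_div, mul_assoc, Real.mul_self_sqrt hpos.le,
      comm (A s) (deriv A s)]
    have hε0 : ε ≠ 0 := by rcases hε with h | h <;> simp [h]
    have := hαF s hs
    field_simp
    ring
  intro s hs
  obtain ⟨t, ht, hD⟩ := hnondeg s hs
  set b := deriv β t
  set c := deriv (deriv β) t
  have hm : ∀ u ∈ I, det3 (T u) (A u) b = det3 (T u) b c := fun u hu => by
    have h := hmax u hu t ht
    simp only [det3] at h ⊢
    linarith
  have dD : ∀ u ∈ I, HasDerivAt (fun x => det3 (T x) (A x) b)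
      (lprod (deriv A u) (A u) / lprod (A u) (A u) * det3 (T u) (A u) b) u := by
    intro u hu
    refine ((d₁ u hu).det3_const_right (d₂ u hu) b).congr_deriv ?_
    conv_lhs => rw [frenet u hu]
    simp only [det3, Pi.add_apply, Pi.smul_apply, smul_eq_mul]
    ring
  have dm : ∀ f : ℝ → Fin 3 → ℝ, ∀ f' u, HasDerivAt f f' u →
      HasDerivAt (fun x => det3 (f x) b c) (det3 f' b c) u := by
    intro f f' u hf
    rw [hasDerivAt_pi] at hf
    refine ((((hf 0).mul_const (b 1 * c 2 - b 2 * c 1)).sub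
      ((hf 1).mul_const (b 0 * c 2 - b 2 * c 0))).add
      ((hf 2).mul_const (b 0 * c 1 - b 1 * c 0))).congr_deriv ?_
    simp only [det3]
  have hm' : ∀ u ∈ I, det3 (A u) b c =
      lprod (deriv A u) (A u) / lprod (A u) (A u) * det3 (T u) (A u) b := fun u hu =>
    ((dm T _ u (d₁ u hu)).congr_of_eventuallyEq (by
      filter_upwards [hIo.mem_nhds hu] with x hx using hm x hx)).unique (dD u hu)
  have hquot : (fun u => deriv κ u / κ u) =ᶠ[nhds s]
      fun u => det3 (A u) b c / det3 (T u) (A u) b := by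
    filter_upwards [hIo.mem_nhds hs, (dD s hs).continuousAt.eventually_ne hD] with u hu hu0
    rw [hlog u hu, hm' u hu, mul_div_cancel_right₀ _ hu0]
  have hm'' : det3 (deriv A s) b c = -lprod (A s) (A s) * det3 (T s) (A s) b +
      lprod (deriv A s) (A s) / lprod (A s) (A s) * det3 (A s) b c := by
    rw [hm s hs]
    conv_lhs => rw [frenet s hs]
    simp only [det3, Pi.add_apply, Pi.smul_apply, smul_eq_mul]
    ring
  rw [hquot.deriv_eq, ((dm A _ s (d₂ s hs)).fun_div (dD s hs) hD).deriv, hm'', hm' s hs, hκ s hs,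
    Real.sq_sqrt (hεsign s hs).le]
  have hε2 : ε * (ε * lprod (A s) (A s)) = lprod (A s) (A s) := by
    rcases hε with h | h <;> simp [h]
  rw [hε2]
  field_simp
  ring
end

section
/- Fix c > 0 and θ ∈ ℝ, and on the domain Ω = {(s,t) ∈ ℝ² : |cs| < π/2 and |ct| < π/2} define the Scherk-type surface Ψ(s,t) = (s + t cosh θ, (1/c)(log cos(cs) − log cos(ct)), t sinh θ). Then Ψ has zero mean curvature: with E = ⟨Ψ_s,Ψ_s⟩_L, F = ⟨Ψ_s,Ψ_t⟩_L, G = ⟨Ψ_t,Ψ_t⟩_L, one has G·det(Ψ_s, Ψ_t, Ψ_ss) − 2F·det(Ψ_s, Ψ_t, Ψ_st) + E·det(Ψ_s, Ψ_t, Ψ_tt) = 0 at every point of Ω. -/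
open Real

theorem hasDerivAt_vec3 {f g h : ℝ → ℝ} {f' g' h' x : ℝ} (hf : HasDerivAt f f' x)
    (hg : HasDerivAt g g' x) (hh : HasDerivAt h h' x) :
    HasDerivAt (fun y => ![f y, g y, h y]) ![f', g', h'] x := by
  rw [hasDerivAt_pi]
  intro i
  fin_cases i
  · exact hf
  · exact hg
  · exact hh

theorem hasDerivAt_log_cos_const_mul (c : ℝ) {x : ℝ} (hx : cos (c * x) ≠ 0) :
    HasDerivAt (fun y => log (cos (c * y))) (-(c * tan (c * x))) x := by
  have h := (((hasDerivAt_id x).const_mul c).cos).log hx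
  refine h.congr_deriv ?_
  simp only [id, mul_one, tan_eq_sin_div_cos]
  ring

theorem hasDerivAt_tan_const_mul (c : ℝ) {x : ℝ} (hx : cos (c * x) ≠ 0) :
    HasDerivAt (fun y => tan (c * y)) (c * (1 + tan (c * x) ^ 2)) x := by
  have h := (hasDerivAt_tan hx).comp x ((hasDerivAt_id x).const_mul c)
  refine h.congr_deriv ?_
  rw [← inv_one_add_tan_sq hx]
  simp [mul_comm]

theorem eventually_cos_const_mul_ne_zero (c : ℝ) {x : ℝ} (hx : cos (c * x) ≠ 0) :
    ∀ᶠ y in nhds x, cos (c * y) ≠ 0 :=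
  ContinuousAt.eventually_ne (by fun_prop) hx

/-- the Scherk-type surface
`Ψ(s,t) = (s + t·cosh θ, (1/c)(log cos(cs) − log cos(ct)), t·sinh θ)` has zero mean
curvature on `{|cs| < π/2, |ct| < π/2}`. -/
theorem stmt_17 (c θ : ℝ) (hc : 0 < c)
    (Ψ : ℝ → ℝ → Fin 3 → ℝ)
    (hΨ : ∀ s t : ℝ, Ψ s t =
      ![s + t * Real.cosh θ,
        (1 / c) * (Real.log (Real.cos (c * s)) - Real.log (Real.cos (c * t))),
        t * Real.sinh θ]) :
    ∀ s t : ℝ, |c * s| < Real.pi / 2 → |c * t| < Real.pi / 2 →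
      lprod (deriv (Ψ s) t) (deriv (Ψ s) t) *
          det3 (deriv (fun u => Ψ u t) s) (deriv (Ψ s) t)
            (deriv (deriv (fun u => Ψ u t)) s) -
        2 * lprod (deriv (fun u => Ψ u t) s) (deriv (Ψ s) t) *
          det3 (deriv (fun u => Ψ u t) s) (deriv (Ψ s) t)
            (deriv (fun v => deriv (fun u => Ψ u v) s) t) +
        lprod (deriv (fun u => Ψ u t) s) (deriv (fun u => Ψ u t) s) *
          det3 (deriv (fun u => Ψ u t) s) (deriv (Ψ s) t)
            (deriv (deriv (Ψ s)) t) = 0 := by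
  intro s t hs ht
  have cos_ne {x : ℝ} (hx : |x| < π / 2) : cos x ≠ 0 :=
    (cos_pos_of_mem_Ioo (abs_lt.mp hx)).ne'
  have hs' := cos_ne hs
  have ht' := cos_ne ht
  have deriv_fst (u v : ℝ) (hu : cos (c * u) ≠ 0) :
      deriv (fun u => Ψ u v) u = ![1, -tan (c * u), 0] := by
    simp only [hΨ]
    refine (hasDerivAt_vec3 ((hasDerivAt_id u).add_const _)
      ((((hasDerivAt_log_cos_const_mul c hu).sub_const _).const_mul (1 / c)).congr_deriv ?_)
      (hasDerivAt_const u _)).deriv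
    field_simp
  have deriv_snd (u v : ℝ) (hv : cos (c * v) ≠ 0) :
      deriv (Ψ u) v = ![cosh θ, tan (c * v), sinh θ] := by
    rw [show Ψ u = _ from funext (hΨ u)]
    refine (hasDerivAt_vec3
      ((((hasDerivAt_id v).mul_const (cosh θ)).const_add u).congr_deriv (one_mul _))
      ((((hasDerivAt_log_cos_const_mul c hv).const_sub _).const_mul (1 / c)).congr_deriv ?_)
      (((hasDerivAt_id v).mul_const (sinh θ)).congr_deriv (one_mul _))).deriv
    field_simp
  have deriv_fst_fst : deriv (deriv (fun u => Ψ u t)) s =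
      ![0, -(c * (1 + tan (c * s) ^ 2)), 0] := by
    rw [Filter.EventuallyEq.deriv_eq ((eventually_cos_const_mul_ne_zero c hs').mono
      fun u hu => deriv_fst u t hu)]
    exact (hasDerivAt_vec3 (hasDerivAt_const s _) (hasDerivAt_tan_const_mul c hs').fun_neg
      (hasDerivAt_const s _)).deriv
  have deriv_snd_snd : deriv (deriv (Ψ s)) t = ![0, c * (1 + tan (c * t) ^ 2), 0] := by
    rw [Filter.EventuallyEq.deriv_eq ((eventually_cos_const_mul_ne_zero c ht').mono
      fun v hv => deriv_snd s v hv)]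
    exact (hasDerivAt_vec3 (hasDerivAt_const t _) (hasDerivAt_tan_const_mul c ht')
      (hasDerivAt_const t _)).deriv
  have deriv_fst_snd : deriv (fun v => deriv (fun u => Ψ u v) s) t = 0 := by
    simp only [deriv_fst s _ hs', deriv_const]
  rw [deriv_fst_fst, deriv_snd_snd, deriv_fst_snd, deriv_fst s t hs', deriv_snd s t ht']
  simp only [lprod, det3, Matrix.cons_val, Pi.zero_apply]
  linear_combination c * sinh θ * (1 + tan (c * s) ^ 2) * cosh_sq θ
end

section
/- Fix c > 0 and θ ∈ ℝ, and on ℝ² define the Scherk-type surface Ψ(s,t) = (s + t cos θ, −t sin θ, (1/c)(log cosh(cs) − log cosh(ct))). Then Ψ has zero mean curvature: with E = ⟨Ψ_s,Ψ_s⟩_L, F = ⟨Ψ_s,Ψ_t⟩_L, G = ⟨Ψ_t,Ψ_t⟩_L, one has G·det(Ψ_s, Ψ_t, Ψ_ss) − 2F·det(Ψ_s, Ψ_t, Ψ_st) + E·det(Ψ_s, Ψ_t, Ψ_tt) = 0 at every point of ℝ². -/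
open Real

theorem hasDerivAt_log_cosh_mul (c x : ℝ) :
    HasDerivAt (fun y => Real.log (Real.cosh (c * y)))
      (c * (Real.sinh (c * x) / Real.cosh (c * x))) x := by
  have h := (((hasDerivAt_id' x).const_mul c).cosh).log (Real.cosh_pos _).ne'
  refine h.congr_deriv ?_
  ring

theorem hasDerivAt_sinh_div_cosh_mul (c x : ℝ) :
    HasDerivAt (fun y => Real.sinh (c * y) / Real.cosh (c * y))
      (c * (1 - (Real.sinh (c * x) / Real.cosh (c * x)) ^ 2)) x := by
  have hx := (Real.cosh_pos (c * x)).ne'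
  have h := (((hasDerivAt_id' x).const_mul c).sinh).div (((hasDerivAt_id' x).const_mul c).cosh) hx
  refine h.congr_deriv ?_
  field_simp

/-- the Scherk-type surface
`Ψ(s,t) = (s + t·cos θ, −t·sin θ, (1/c)(log cosh(cs) − log cosh(ct)))` has zero mean
curvature on all of ℝ². -/
theorem stmt_18 (c θ : ℝ) (hc : 0 < c)
    (Ψ : ℝ → ℝ → Fin 3 → ℝ)
    (hΨ : ∀ s t : ℝ, Ψ s t =
      ![s + t * Real.cos θ,
        -t * Real.sin θ,
        (1 / c) * (Real.log (Real.cosh (c * s)) - Real.log (Real.cosh (c * t)))]) :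
    ∀ s t : ℝ,
      lprod (deriv (Ψ s) t) (deriv (Ψ s) t) *
          det3 (deriv (fun u => Ψ u t) s) (deriv (Ψ s) t)
            (deriv (deriv (fun u => Ψ u t)) s) -
        2 * lprod (deriv (fun u => Ψ u t) s) (deriv (Ψ s) t) *
          det3 (deriv (fun u => Ψ u t) s) (deriv (Ψ s) t)
            (deriv (fun v => deriv (fun u => Ψ u v) s) t) +
        lprod (deriv (fun u => Ψ u t) s) (deriv (fun u => Ψ u t) s) *
          det3 (deriv (fun u => Ψ u t) s) (deriv (Ψ s) t)
            (deriv (deriv (Ψ s)) t) = 0 := by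
  have hs : ∀ t, deriv (fun u => Ψ u t) =
      fun s => ![1, 0, Real.sinh (c * s) / Real.cosh (c * s)] := by
    intro t
    funext s
    simp only [hΨ]
    refine (hasDerivAt_vec3 ((hasDerivAt_id s).add_const _) (hasDerivAt_const s _) ?_).deriv
    refine (((hasDerivAt_log_cosh_mul c s).sub_const (Real.log (Real.cosh (c * t)))).const_mul (1 / c)).congr_deriv ?_
    field_simp
  have ht : ∀ s, deriv (Ψ s) =
      fun t => ![Real.cos θ, -Real.sin θ, -(Real.sinh (c * t) / Real.cosh (c * t))] := by
    intro s
    funext t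
    rw [funext (hΨ s)]
    refine (hasDerivAt_vec3 ?_ ?_ ?_).deriv
    · simpa using ((hasDerivAt_id t).mul_const (Real.cos θ)).const_add s
    · simpa using (hasDerivAt_id t).neg.mul_const (Real.sin θ)
    · refine (((hasDerivAt_log_cosh_mul c t).const_sub (Real.log (Real.cosh (c * s)))).const_mul (1 / c)).congr_deriv ?_
      field_simp
  intro s t
  have hss := (hasDerivAt_vec3 (hasDerivAt_const s (1 : ℝ)) (hasDerivAt_const s (0 : ℝ))
    (hasDerivAt_sinh_div_cosh_mul c s)).deriv
  have htt := (hasDerivAt_vec3 (hasDerivAt_const t (Real.cos θ))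
    (hasDerivAt_const t (-Real.sin θ)) (hasDerivAt_sinh_div_cosh_mul c t).neg).deriv
  simp only [Pi.neg_apply] at htt
  simp only [hs, ht, deriv_const, hss, htt, lprod, det3, Matrix.cons_val, Pi.zero_apply]
  linear_combination (-c * Real.sin θ * (1 - (Real.sinh (c * s) / Real.cosh (c * s)) ^ 2)) *
    Real.cos_sq_add_sin_sq θ
end

section
/- Fix c > 0 and θ ∈ ℝ, and on the domain Ω = {(s,t) ∈ ℝ² : |cs| < π/2 and t > 0} define the Scherk-type surface Ψ(s,t) = (s + t sinh θ, (1/c)(log cos(cs) − log sinh(ct)), t cosh θ). Then Ψ has zero mean curvature: with E = ⟨Ψ_s,Ψ_s⟩_L, F = ⟨Ψ_s,Ψ_t⟩_L, G = ⟨Ψ_t,Ψ_t⟩_L, one has G·det(Ψ_s, Ψ_t, Ψ_ss) − 2F·det(Ψ_s, Ψ_t, Ψ_st) + E·det(Ψ_s, Ψ_t, Ψ_tt) = 0 at every point of Ω. -/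
open Real

theorem hasDerivAt_log_cos_mul (c x : ℝ) (hx : cos (c * x) ≠ 0) :
    HasDerivAt (fun y => log (cos (c * y))) (-sin (c * x) * c / cos (c * x)) x := by
  have h : HasDerivAt (fun y => c * y) c x := by
    simpa using (hasDerivAt_id x).const_mul c
  exact h.cos.log hx

theorem hasDerivAt_log_sinh_mul (c x : ℝ) (hx : sinh (c * x) ≠ 0) :
    HasDerivAt (fun y => log (sinh (c * y))) (cosh (c * x) * c / sinh (c * x)) x := by
  have h : HasDerivAt (fun y => c * y) c x := by
    simpa using (hasDerivAt_id x).const_mul c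
  exact h.sinh.log hx

theorem hasDerivAt_neg_sin_div_cos_mul (c x : ℝ) (hx : cos (c * x) ≠ 0) :
    HasDerivAt (fun y => -sin (c * y) / cos (c * y)) (-c / cos (c * x) ^ 2) x := by
  have h : HasDerivAt (fun y => c * y) c x := by
    simpa using (hasDerivAt_id x).const_mul c
  refine (h.sin.fun_neg.fun_div h.cos hx).congr_deriv ?_
  congr 1
  linear_combination -c * sin_sq_add_cos_sq (c * x)

theorem hasDerivAt_neg_cosh_div_sinh_mul (c x : ℝ) (hx : sinh (c * x) ≠ 0) :
    HasDerivAt (fun y => -cosh (c * y) / sinh (c * y)) (c / sinh (c * x) ^ 2) x := by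
  have h : HasDerivAt (fun y => c * y) c x := by
    simpa using (hasDerivAt_id x).const_mul c
  refine (h.cosh.fun_neg.fun_div h.sinh hx).congr_deriv ?_
  congr 1
  linear_combination c * cosh_sq_sub_sinh_sq (c * x)

/-- the Scherk-type surface
`Ψ(s,t) = (s + t·sinh θ, (1/c)(log cos(cs) − log sinh(ct)), t·cosh θ)` has zero mean
curvature on `{|cs| < π/2, t > 0}`. -/
theorem stmt_19 (c θ : ℝ) (hc : 0 < c)
    (Ψ : ℝ → ℝ → Fin 3 → ℝ)
    (hΨ : ∀ s t : ℝ, Ψ s t =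
      ![s + t * Real.sinh θ,
        (1 / c) * (Real.log (Real.cos (c * s)) - Real.log (Real.sinh (c * t))),
        t * Real.cosh θ]) :
    ∀ s t : ℝ, |c * s| < Real.pi / 2 → 0 < t →
      lprod (deriv (Ψ s) t) (deriv (Ψ s) t) *
          det3 (deriv (fun u => Ψ u t) s) (deriv (Ψ s) t)
            (deriv (deriv (fun u => Ψ u t)) s) -
        2 * lprod (deriv (fun u => Ψ u t) s) (deriv (Ψ s) t) *
          det3 (deriv (fun u => Ψ u t) s) (deriv (Ψ s) t)
            (deriv (fun v => deriv (fun u => Ψ u v) s) t) +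
        lprod (deriv (fun u => Ψ u t) s) (deriv (fun u => Ψ u t) s) *
          det3 (deriv (fun u => Ψ u t) s) (deriv (Ψ s) t)
            (deriv (deriv (Ψ s)) t) = 0 := by
  intro s t hs ht
  have hcos : cos (c * s) ≠ 0 :=
    (cos_pos_of_mem_Ioo ⟨(abs_lt.mp hs).1, (abs_lt.mp hs).2⟩).ne'
  have hsinh : sinh (c * t) ≠ 0 := (sinh_pos_iff.mpr (mul_pos hc ht)).ne'
  have hΨs : ∀ u v, cos (c * u) ≠ 0 →
      deriv (fun u => Ψ u v) u = ![1, -sin (c * u) / cos (c * u), 0] := by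
    intro u v hu
    simp only [hΨ]
    refine (hasDerivAt_vec3 ((hasDerivAt_id' u).add_const _) ?_ (hasDerivAt_const _ _)).deriv
    refine (((hasDerivAt_log_cos_mul c u hu).sub_const _).const_mul (1 / c)).congr_deriv ?_
    field_simp
  have hΨt : ∀ u v, sinh (c * v) ≠ 0 →
      deriv (Ψ u) v = ![sinh θ, -cosh (c * v) / sinh (c * v), cosh θ] := by
    intro u v hv
    rw [funext (hΨ u)]
    refine (hasDerivAt_vec3 ?_ ?_ ?_).deriv
    · simpa using ((hasDerivAt_id' v).mul_const (sinh θ)).const_add u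
    · refine (((hasDerivAt_log_sinh_mul c v hv).const_sub _).const_mul (1 / c)).congr_deriv ?_
      field_simp
    · simpa using (hasDerivAt_id' v).mul_const (cosh θ)
  have hΨss : deriv (deriv (fun u => Ψ u t)) s = ![0, -c / cos (c * s) ^ 2, 0] := by
    have hev : ∀ᶠ u in nhds s, cos (c * u) ≠ 0 :=
      ContinuousAt.eventually_ne (g := fun u => cos (c * u)) (by fun_prop) hcos
    rw [Filter.EventuallyEq.deriv_eq (hev.mono fun u hu => hΨs u t hu)]
    exact (hasDerivAt_vec3 (hasDerivAt_const _ _) (hasDerivAt_neg_sin_div_cos_mul c s hcos)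
      (hasDerivAt_const _ _)).deriv
  have hΨst : deriv (fun v => deriv (fun u => Ψ u v) s) t = 0 := by
    simp only [hΨs s _ hcos, deriv_const]
  have hΨtt : deriv (deriv (Ψ s)) t = ![0, c / sinh (c * t) ^ 2, 0] := by
    have hev : ∀ᶠ v in nhds t, sinh (c * v) ≠ 0 :=
      ContinuousAt.eventually_ne (g := fun v => sinh (c * v)) (by fun_prop) hsinh
    rw [Filter.EventuallyEq.deriv_eq (hev.mono fun v hv => hΨt s v hv)]
    exact (hasDerivAt_vec3 (hasDerivAt_const _ _) (hasDerivAt_neg_cosh_div_sinh_mul c t hsinh)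
      (hasDerivAt_const _ _)).deriv
  have hE : 1 + (-sin (c * s) / cos (c * s)) ^ 2 = 1 / cos (c * s) ^ 2 := by
    field_simp
    linear_combination sin_sq_add_cos_sq (c * s)
  have hG : (-cosh (c * t) / sinh (c * t)) ^ 2 - 1 = 1 / sinh (c * t) ^ 2 := by
    field_simp
    linear_combination cosh_sq_sub_sinh_sq (c * t)
  rw [hΨss, hΨst, hΨtt, hΨs s t hcos, hΨt s t hsinh]
  simp only [lprod, det3, Matrix.cons_val, Pi.zero_apply]
  linear_combination (cosh θ * c / cos (c * s) ^ 2) * (hG - cosh_sq_sub_sinh_sq θ) -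
    (cosh θ * c / sinh (c * t) ^ 2) * hE
end
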